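/- Let q be a complex number with 0 < |q| < 1, let λ be a nonzero complex number, let k be an integer, and let x be a nonzero complex number with x ∉ {−λ q^m : m ∈ ℤ}. Then the series Σ_{n∈ℤ} (λq^n)^k / θ_q(λq^n/x) converges absolutely and equals q^{−k(k−1)/2} x^k. -/

import Mathlib

open Complex Filter Topology

noncomputable def qPochInt (q a : ℂ) (n : ℤ) : ℂ :=
  if 0 ≤ n then ∏ k ∈ Finset.range n.toNat, (1 - a * q ^ k)
  else (∏ k ∈ Finset.range (-n).toNat, (1 - a * q ^ (-(k + 1 : ℤ))))⁻¹

noncomputable def qPochInf (q a : ℂ) : ℂ := ∏' k : ℕ, (1 - a * q ^ k)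

noncomputable def thetaQ (q z : ℂ) : ℂ := ∑' n : ℤ, q ^ (n * (n - 1) / 2) * z ^ n

lemma triQ_add (n k : ℤ) :
    (n + k) * (n + k - 1) / 2 = n * (n - 1) / 2 + k * (k - 1) / 2 + n * k := by
  obtain ⟨a, ha⟩ := Int.even_mul_pred_self n
  obtain ⟨b, hb⟩ := Int.even_mul_pred_self k
  have h : (n + k) * (n + k - 1) = 2 * (a + b + n * k) := by linear_combination ha + hb
  rw [h, show n * (n - 1) = 2 * a by omega, show k * (k - 1) = 2 * b by omega]
  simp

lemma triQ_succ (n : ℤ) : (n + 1) * (n + 1 - 1) / 2 = n * (n - 1) / 2 + n := by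
  rw [triQ_add]; simp

lemma summable_thetaQ (q z : ℂ) (hq0 : q ≠ 0) (hq1 : ‖q‖ < 1) (hz : z ≠ 0) :
    Summable (fun n : ℤ => q ^ (n * (n - 1) / 2) * z ^ n) := by
  have hlim : Tendsto (fun n : ℕ => q ^ n) atTop (𝓝 0) :=
    tendsto_pow_atTop_nhds_zero_of_norm_lt_one hq1
  apply Summable.of_nat_of_neg
  · refine summable_of_ratio_test_tendsto_lt_one (l := 0) zero_lt_one ?_ ?_
    · exact Eventually.of_forall fun n => mul_ne_zero (zpow_ne_zero _ hq0) (zpow_ne_zero _ hz)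
    · have h : Tendsto (fun n : ℕ => ‖q ^ n * z‖) atTop (𝓝 0) := by
        simpa using (hlim.mul_const z).norm
      refine h.congr fun n => ?_
      rw [← norm_div]
      congr 1
      push_cast
      rw [triQ_succ, zpow_add₀ hq0, zpow_add₀ hz, zpow_natCast q n, zpow_one]
      have h1 := zpow_ne_zero ((n : ℤ) * (n - 1) / 2) hq0
      have h2 := zpow_ne_zero (n : ℤ) hz
      field_simp
  · refine summable_of_ratio_test_tendsto_lt_one (l := 0) zero_lt_one ?_ ?_
    · exact Eventually.of_forall fun n => mul_ne_zero (zpow_ne_zero _ hq0) (zpow_ne_zero _ hz)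
    · have h : Tendsto (fun n : ℕ => ‖q ^ n * (q * z⁻¹)‖) atTop (𝓝 0) := by
        simpa using (hlim.mul_const (q * z⁻¹)).norm
      refine h.congr fun n => ?_
      rw [← norm_div]
      congr 1
      have h3 := triQ_succ (-((n + 1 : ℕ) : ℤ))
      have h4 : -((n + 1 : ℕ) : ℤ) + 1 = -(n : ℤ) := by push_cast; ring
      rw [h4] at h3
      have h5 : -((n + 1 : ℕ) : ℤ) * (-((n + 1 : ℕ) : ℤ) - 1) / 2
          = -(n : ℤ) * (-(n : ℤ) - 1) / 2 + n + 1 := by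
        rw [h3]; push_cast; ring
      rw [h5, zpow_add₀ hq0, zpow_add₀ hq0,
        show -((n + 1 : ℕ) : ℤ) = -(n : ℤ) + (-1) by push_cast; ring,
        zpow_add₀ hz, zpow_natCast q n, zpow_one, zpow_neg_one]
      have h1 := zpow_ne_zero (-(n : ℤ) * (-(n : ℤ) - 1) / 2) hq0
      have h2 := zpow_ne_zero (-(n : ℤ)) hz
      field_simp

lemma thetaQ_shift (q z : ℂ) (hq0 : q ≠ 0) (hz : z ≠ 0) (k : ℤ) :
    thetaQ q (z * q ^ k) = z ^ (-k) * q ^ (-(k * (k - 1) / 2)) * thetaQ q z := by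
  unfold thetaQ
  rw [← (Equiv.addRight k).tsum_eq (fun n : ℤ => q ^ (n * (n - 1) / 2) * z ^ n), ← tsum_mul_left]
  congr 1
  ext n
  simp only [Equiv.coe_addRight]
  rw [triQ_add, zpow_add₀ hq0, zpow_add₀ hq0, zpow_add₀ hz, mul_zpow, ← zpow_mul, zpow_neg,
    zpow_neg, mul_comm k n]
  have h1 := zpow_ne_zero (k * (k - 1) / 2) hq0
  have h2 := zpow_ne_zero k hz
  field_simp

/-- The finite product `(q;q)_n`. -/
noncomputable def qfac (q : ℂ) (n : ℕ) : ℂ := ∏ j ∈ Finset.range n, (1 - q ^ (j + 1))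

/-- The reciprocal of `(q;q)_n`, extended by zero to negative integers. -/
noncomputable def rfac (q : ℂ) (n : ℤ) : ℂ := if 0 ≤ n then (qfac q n.toNat)⁻¹ else 0

lemma one_sub_ne (q : ℂ) (hq1 : ‖q‖ < 1) (j : ℕ) : 1 - q ^ (j + 1) ≠ 0 := by
  intro h
  have h1 : ‖q ^ (j + 1)‖ = 1 := by rw [← sub_eq_zero.mp h]; simp
  rw [norm_pow] at h1
  exact (pow_lt_one₀ (norm_nonneg q) hq1 (Nat.succ_ne_zero j)).ne h1

lemma rfac_rec (q : ℂ) (hq1 : ‖q‖ < 1) (n : ℤ) :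
    rfac q n = (1 - q ^ (n + 1)) * rfac q (n + 1) := by
  unfold rfac
  rcases lt_trichotomy n (-1) with h | h | h
  · rw [if_neg (by omega), if_neg (by omega), mul_zero]
  · subst h; simp
  · have h0 : 0 ≤ n := by omega
    lift n to ℕ using h0
    rw [if_pos (by omega), if_pos (by omega)]
    have : ((n : ℤ) + 1).toNat = n + 1 := by omega
    rw [this, Int.toNat_natCast, qfac, qfac, Finset.prod_range_succ, mul_inv]
    have h1 := one_sub_ne q hq1 n
    have h2 : q ^ ((n : ℤ) + 1) = q ^ (n + 1) := by exact_mod_cast zpow_natCast q (n + 1)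
    rw [h2]
    field_simp

lemma finite_triple (q z : ℂ) (hq0 : q ≠ 0) (hq1 : ‖q‖ < 1) (hz : z ≠ 0) (m : ℕ) :
    HasSum (fun n : ℤ => qfac q (2 * m) * rfac q (m + n) * rfac q (m - n) *
        (q ^ (n * (n - 1) / 2) * z ^ n))
      (∏ j ∈ Finset.range m, ((1 + z * q ^ j) * (1 + q ^ (j + 1) * z⁻¹))) := by
  induction m with
  | zero =>
    have h := hasSum_single (f := fun n : ℤ => qfac q (2 * 0) * rfac q ((0 : ℕ) + n) *
        rfac q ((0 : ℕ) - n) * (q ^ (n * (n - 1) / 2) * z ^ n)) 0 (by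
      intro n hn
      rcases lt_or_gt_of_ne hn with h | h
      · simp [rfac, not_le.mpr h]
      · simp [rfac, not_le.mpr h])
    simpa [rfac, qfac] using h
  | succ m ih =>
    rw [Finset.prod_range_succ]
    set S := ∏ j ∈ Finset.range m, ((1 + z * q ^ j) * (1 + q ^ (j + 1) * z⁻¹)) with hS
    have hA := ih.mul_left (1 + q ^ (2 * m + 1))
    have hB := ((Equiv.subRight (1 : ℤ)).hasSum_iff.mpr ih).mul_left (z * q ^ m)
    have hC := ((Equiv.addRight (1 : ℤ)).hasSum_iff.mpr ih).mul_left (q ^ (m + 1) * z⁻¹)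
    refine Eq.mpr (congrArg₂ (fun (f : ℤ → ℂ) (s : ℂ) => HasSum f s) ?_ ?_) ((hA.add hB).add hC)
    · ext n
      simp only [Function.comp, Equiv.subRight_apply, Equiv.coe_addRight]
      have e1 := triQ_succ (n - 1)
      rw [sub_add_cancel] at e1
      have e1' : (n - 1) * (n - 1 - 1) / 2 = n * (n - 1) / 2 + 1 - n := by rw [e1]; ring
      rw [e1', triQ_succ n]
      have r1 := rfac_rec q hq1 (m + n)
      have r2 := rfac_rec q hq1 (m - n)
      have r3 := rfac_rec q hq1 (m + (n - 1))
      have r4 := rfac_rec q hq1 (m - (n + 1))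
      rw [show (m : ℤ) + (n - 1) + 1 = m + n by ring] at r3
      rw [show (m : ℤ) - (n + 1) + 1 = m - n by ring] at r4
      rw [show (m : ℤ) - (n - 1) = m - n + 1 by ring, show (m : ℤ) + (n + 1) = m + n + 1 by ring,
        r3, r4, r1, r2]
      rw [show ((m + 1 : ℕ) : ℤ) + n = m + n + 1 by push_cast; ring,
        show ((m + 1 : ℕ) : ℤ) - n = m - n + 1 by push_cast; ring]
      have hf : qfac q (2 * (m + 1)) =
          qfac q (2 * m) * (1 - q ^ (2 * m + 1)) * (1 - q ^ (2 * m + 2)) := by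
        rw [show 2 * (m + 1) = 2 * m + 1 + 1 by ring, qfac, Finset.prod_range_succ,
          Finset.prod_range_succ, qfac]
      rw [hf]
      generalize rfac q (m + n + 1) = A
      generalize rfac q (m - n + 1) = B
      generalize qfac q (2 * m) = F
      generalize n * (n - 1) / 2 = t
      have hqn := zpow_ne_zero n hq0
      have hqm := pow_ne_zero m hq0
      have hzn := zpow_ne_zero n hz
      have hqt := zpow_ne_zero t hq0
      simp only [zpow_add₀ hq0, zpow_sub₀ hq0, zpow_add₀ hz, zpow_sub₀ hz, zpow_one, zpow_natCast,
        pow_add, pow_mul', pow_one]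
      generalize q ^ n = a at *
      generalize q ^ m = b at *
      generalize q ^ t = c at *
      generalize z ^ n = d at *
      field_simp
      ring
    · field_simp
      ring

lemma thetaQ_ne_zero (q z : ℂ) (hq0 : q ≠ 0) (hq1 : ‖q‖ < 1) (hz : z ≠ 0)
    (h : ∀ m : ℤ, z ≠ -q ^ m) : thetaQ q z ≠ 0 := by
  have hgeo : ∀ c : ℂ, Summable (fun j : ℕ => ‖c * q ^ j‖) := fun c => by
    simp only [norm_mul, norm_pow]
    exact (summable_geometric_of_lt_one (norm_nonneg _) hq1).mul_left _
  have key : ∀ c : ℂ, (∀ j : ℕ, 1 + c * q ^ j ≠ 0) → ∃ L : ℂ, L ≠ 0 ∧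
      Tendsto (fun m => ∏ j ∈ Finset.range m, (1 + c * q ^ j)) atTop (𝓝 L) := fun c hc =>
    ⟨_, tprod_one_add_ne_zero_of_summable hc (hgeo c),
      (multipliable_one_add_of_summable (hgeo c)).hasProd.tendsto_prod_nat⟩
  obtain ⟨L1, hL1, t1⟩ := key z (fun j hj => h (-j) (by
    have := pow_ne_zero j hq0
    rw [zpow_neg, zpow_natCast]
    field_simp
    linear_combination hj))
  obtain ⟨L2, hL2, t2⟩ := key (q * z⁻¹) (fun j hj => h (j + 1) (by
    have h2 : q ^ ((j : ℤ) + 1) = q ^ (j + 1) := by exact_mod_cast zpow_natCast q (j + 1)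
    rw [h2, pow_succ]
    field_simp at hj
    linear_combination hj))
  obtain ⟨Q, hQ, t3⟩ := key (-q) (fun j => by
    have := one_sub_ne q hq1 j
    rwa [pow_succ', sub_eq_add_neg, ← neg_mul] at this)
  have tq : Tendsto (qfac q) atTop (𝓝 Q) := by
    refine t3.congr fun m => Finset.prod_congr rfl fun j _ => ?_
    ring
  have tqi : Tendsto (fun n => (qfac q n)⁻¹) atTop (𝓝 Q⁻¹) := tq.inv₀ hQ
  obtain ⟨M, hM⟩ := (Metric.isBounded_range_of_tendsto _ tq).exists_norm_le
  obtain ⟨K, hK⟩ := (Metric.isBounded_range_of_tendsto _ tqi).exists_norm_le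
  have hM' : ∀ n, ‖qfac q n‖ ≤ M := fun n => hM _ ⟨n, rfl⟩
  have hK' : ∀ n, ‖(qfac q n)⁻¹‖ ≤ K := fun n => hK _ ⟨n, rfl⟩
  have hK0 : 0 ≤ K := (norm_nonneg _).trans (hK' 0)
  have hM0 : 0 ≤ M := (norm_nonneg _).trans (hM' 0)
  have hr : ∀ n, ‖rfac q n‖ ≤ K := fun n => by
    unfold rfac
    split_ifs
    · exact hK' _
    · simpa using hK0
  have tr : Tendsto (rfac q) atTop (𝓝 Q⁻¹) := by
    have hto : Tendsto Int.toNat atTop atTop :=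
      tendsto_atTop.mpr fun b => (eventually_ge_atTop (b : ℤ)).mono fun a ha => by omega
    refine (tqi.comp hto).congr' ?_
    filter_upwards [eventually_ge_atTop 0] with n hn
    simp [rfac, hn]
  have hsum := summable_thetaQ q z hq0 hq1 hz
  have T := tendsto_tsum_of_dominated_convergence (𝓕 := atTop)
    (f := fun (m : ℕ) (n : ℤ) => qfac q (2 * m) * rfac q (m + n) * rfac q (m - n) *
        (q ^ (n * (n - 1) / 2) * z ^ n))
    (g := fun n => Q * Q⁻¹ * Q⁻¹ * (q ^ (n * (n - 1) / 2) * z ^ n))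
    (bound := fun n => M * K * K * ‖q ^ (n * (n - 1) / 2) * z ^ n‖)
    (hsum.norm.mul_left _)
    (fun n => by
      have c : Tendsto (fun m : ℕ => (m : ℤ)) atTop atTop := tendsto_natCast_atTop_atTop
      have a1 : Tendsto (fun m : ℕ => (m : ℤ) + n) atTop atTop :=
        tendsto_atTop_add_const_right _ _ c
      have a2 : Tendsto (fun m : ℕ => (m : ℤ) - n) atTop atTop := by
        simpa [sub_eq_add_neg] using tendsto_atTop_add_const_right _ (-n) c
      have a3 : Tendsto (fun m : ℕ => 2 * m) atTop atTop :=
        tendsto_atTop_mono (fun m => by simp only [id]; omega) tendsto_id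
      exact (((tq.comp a3).mul (tr.comp a1)).mul (tr.comp a2)).mul_const _)
    (Eventually.of_forall fun m n => by
      simp only [norm_mul]
      gcongr
      · exact hM' _
      · exact hr _
      · exact hr _)
  simp only [(finite_triple q z hq0 hq1 hz _).tsum_eq, tsum_mul_left] at T
  have T2 : Tendsto (fun m => ∏ j ∈ Finset.range m, ((1 + z * q ^ j) * (1 + q ^ (j + 1) * z⁻¹)))
      atTop (𝓝 (L1 * L2)) := by
    refine (t1.mul t2).congr fun m => ?_
    rw [Finset.prod_mul_distrib]
    congr 1
    refine Finset.prod_congr rfl fun j _ => ?_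
    ring
  have e := tendsto_nhds_unique T T2
  intro h0
  unfold thetaQ at h0
  rw [h0, mul_zero] at e
  exact mul_ne_zero hL1 hL2 e.symm

theorem stmt_16 (q lam x : ℂ) (k : ℤ)
    (hq0 : 0 < ‖q‖) (hq1 : ‖q‖ < 1)
    (hlam : lam ≠ 0) (hx : x ≠ 0)
    (hxl : ∀ m : ℤ, x ≠ -(lam * q ^ m)) :
    HasSum (fun n : ℤ => (lam * q ^ n) ^ k / thetaQ q (lam * q ^ n / x))
      (q ^ (-(k * (k - 1) / 2)) * x ^ k) := by
  have hq : q ≠ 0 := norm_pos_iff.mp hq0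
  have hz : lam / x ≠ 0 := div_ne_zero hlam hx
  have hth : thetaQ q (lam / x) ≠ 0 := by
    refine thetaQ_ne_zero q _ hq hq1 hz fun m hm => hxl (-m) ?_
    have := zpow_ne_zero m hq
    rw [zpow_neg]
    field_simp at hm ⊢
    rw [hm]; ring
  have hs := (summable_thetaQ q (lam / x * q ^ k) hq hq1
    (mul_ne_zero hz (zpow_ne_zero _ hq))).hasSum.mul_left (lam ^ k / thetaQ q (lam / x))
  change HasSum _ (lam ^ k / thetaQ q (lam / x) * thetaQ q (lam / x * q ^ k)) at hs
  rw [thetaQ_shift q _ hq hz] at hs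
  refine Eq.mpr (congrArg₂ (fun (f : ℤ → ℂ) (s : ℂ) => HasSum f s) ?_ ?_) (hs)
  · ext n
    rw [mul_div_right_comm, thetaQ_shift q _ hq hz, mul_zpow, mul_zpow (lam / x), ← zpow_mul,
      ← zpow_mul, mul_comm k n, zpow_neg, zpow_neg]
    have h1 := zpow_ne_zero (n * (n - 1) / 2) hq
    have h2 := zpow_ne_zero n hz
    generalize (lam / x) ^ n = w at *
    field_simp
  · rw [zpow_neg (lam / x), div_zpow]
    have h1 := zpow_ne_zero k hlam
    have h2 := zpow_ne_zero k hx
    field_simp
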